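/- (Sánchez's formula) Let X = {x_0,...,x_n} be a finite metric space with mgr(X) < ∞. Then mgr(X) = min{p > 0 : det(D_p) = 0 or ⟨D_p^{-1}𝟙, 𝟙⟩ = 0}, where D_p is the p-distance matrix, 𝟙 is the all-ones vector in ℝ^{n+1}, and the condition ⟨D_p^{-1}𝟙, 𝟙⟩ = 0 is considered only when D_p is invertible. -/

import Mathlib

open Matrix BigOperators

/-- A metric space `(X, d)` has `p`-negative type. -/
def IsNegType (X : Type*) [MetricSpace X] (p : ℝ) : Prop :=
  ∀ (N : ℕ) (x : Fin N → X) (ξ : Fin N → ℝ), (∑ i, ξ i) = 0 →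
    ∑ i, ∑ j, dist (x i) (x j) ^ p * ξ i * ξ j ≤ 0

/-- The maximal generalised roundness (supremal `p`-negative type) of a metric space. -/
noncomputable def mgr (X : Type*) [MetricSpace X] : ℝ :=
  sSup {p : ℝ | 0 ≤ p ∧ IsNegType X p}

/-- The `p`-distance matrix `D_p = (d(x_i, x_j)^p)` of the finite metric space
`X = {x_0, …, x_n}` (modelled as a metric on `Fin (n+1)`). -/
noncomputable def Dmat (n : ℕ) [MetricSpace (Fin (n + 1))] (p : ℝ) :
    Matrix (Fin (n + 1)) (Fin (n + 1)) ℝ :=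
  Matrix.of fun i j => dist i j ^ p

section SanchezFormula

open Filter Topology MeasureTheory Set

section QuadraticForms

variable {ι : Type*} [Fintype ι]

/-- The quadratic form `ξ ↦ ∑ i, ∑ j, A i j * ξ i * ξ j` of a kernel `A`. -/
def pairSum (A : ι → ι → ℝ) (ξ : ι → ℝ) : ℝ :=
  ∑ i, ∑ j, A i j * ξ i * ξ j

/-- A kernel is conditionally negative if its quadratic form is nonpositive on vectors of sum
zero. -/
def IsCondNeg (A : ι → ι → ℝ) : Prop :=
  ∀ ξ : ι → ℝ, ∑ i, ξ i = 0 → pairSum A ξ ≤ 0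

/-- A kernel is strictly conditionally negative if its quadratic form is negative on nonzero
vectors of sum zero. -/
def IsStrictCondNeg (A : ι → ι → ℝ) : Prop :=
  ∀ ξ : ι → ℝ, ∑ i, ξ i = 0 → ξ ≠ 0 → pairSum A ξ < 0

lemma pairSum_eq_dotProduct (A : ι → ι → ℝ) (ξ : ι → ℝ) :
    pairSum A ξ = ξ ⬝ᵥ (Matrix.of A *ᵥ ξ) := by
  simp only [pairSum, dotProduct, mulVec, Finset.mul_sum, Matrix.of_apply]
  exact Finset.sum_congr rfl fun i _ => Finset.sum_congr rfl fun j _ => by ring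

lemma posSemidef_of_pairSum_nonneg {A : ι → ι → ℝ} (hsymm : ∀ i j, A i j = A j i)
    (h : ∀ ξ, 0 ≤ pairSum A ξ) : (Matrix.of A).PosSemidef := by
  refine .of_dotProduct_mulVec_nonneg (Matrix.ext fun i j => by simp [hsymm i j]) fun ξ => ?_
  simpa [pairSum_eq_dotProduct] using h ξ

lemma pairSum_nonneg_of_posSemidef {A : ι → ι → ℝ} (hA : (Matrix.of A).PosSemidef)
    (ξ : ι → ℝ) : 0 ≤ pairSum A ξ := by
  simpa [pairSum_eq_dotProduct] using hA.dotProduct_mulVec_nonneg ξ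

lemma posSemidef_entrywise_pow {A : ι → ι → ℝ} (hA : (Matrix.of A).PosSemidef) (k : ℕ) :
    (Matrix.of fun i j => A i j ^ k).PosSemidef := by
  induction k with
  | zero =>
    convert Matrix.posSemidef_vecMulVec_self_star (fun _ : ι => (1 : ℝ)) using 1
    ext i j
    simp [vecMulVec_apply]
  | succ k ih =>
    have h : (Matrix.of fun i j => A i j ^ (k + 1)) =
        (Matrix.of fun i j => A i j ^ k).hadamard (Matrix.of A) := by
      ext i j
      simp [pow_succ]
    rw [h]
    exact ih.hadamard hA

lemma hasSum_pairSum {A : ℕ → ι → ι → ℝ} {B : ι → ι → ℝ}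
    (h : ∀ i j, HasSum (fun k => A k i j) (B i j)) (ξ : ι → ℝ) :
    HasSum (fun k => pairSum (A k) ξ) (pairSum B ξ) :=
  hasSum_sum fun i _ => hasSum_sum fun j _ => ((h i j).mul_right (ξ i)).mul_right (ξ j)

lemma pairSum_const_mul (c : ℝ) (A : ι → ι → ℝ) (ξ : ι → ℝ) :
    pairSum (fun i j => c * A i j) ξ = c * pairSum A ξ := by
  simp only [pairSum, Finset.mul_sum, mul_assoc]

lemma pairSum_const_smul (c : ℝ) (A : ι → ι → ℝ) (ξ : ι → ℝ) :
    pairSum A (c • ξ) = c ^ 2 * pairSum A ξ := by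
  simp only [pairSum, Finset.mul_sum, Pi.smul_apply, smul_eq_mul]
  exact Finset.sum_congr rfl fun i _ => Finset.sum_congr rfl fun j _ => by ring

lemma pairSum_exp_nonneg {A : ι → ι → ℝ} (hA : (Matrix.of A).PosSemidef) (ξ : ι → ℝ) :
    0 ≤ pairSum (fun i j => Real.exp (A i j)) ξ := by
  have h : ∀ i j, HasSum (fun k : ℕ => (k.factorial : ℝ)⁻¹ * A i j ^ k) (Real.exp (A i j)) := by
    intro i j
    rw [Real.exp_eq_exp_ℝ]
    simpa using NormedSpace.exp_series_hasSum_exp' (𝕂 := ℝ) (A i j)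
  refine (hasSum_pairSum h ξ).nonneg fun k => ?_
  rw [pairSum_const_mul]
  exact mul_nonneg (by positivity)
    (pairSum_nonneg_of_posSemidef (posSemidef_entrywise_pow hA k) ξ)

lemma sum_mul_sum_fiber {κ : Type*} [Fintype κ] [DecidableEq ι] (x : κ → ι) (ξ : κ → ℝ)
    (g : ι → ℝ) : ∑ y, g y * ∑ i, (if x i = y then ξ i else 0) = ∑ i, g (x i) * ξ i := by
  simp only [Finset.mul_sum]
  rw [Finset.sum_comm]
  simp

variable {A : ι → ι → ℝ}

lemma IsCondNeg.posSemidef (hA : IsCondNeg A) (hsymm : ∀ i j, A i j = A j i) {o : ι}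
    (ho : A o o = 0) : (Matrix.of fun i j => A i o + A j o - A i j).PosSemidef := by
  classical
  refine posSemidef_of_pairSum_nonneg (fun i j => by rw [hsymm i j]; ring) fun ξ => ?_
  set s := ∑ i, ξ i with hs
  have hneg := hA (ξ - Pi.single o s) (by simp [← hs])
  have h1 : pairSum A (ξ - Pi.single o s) = pairSum A ξ - 2 * s * ∑ i, A i o * ξ i := by
    simp only [pairSum_eq_dotProduct, mulVec_sub, sub_dotProduct, dotProduct_sub, mulVec_single,
      single_dotProduct]
    simp only [dotProduct, mulVec, Matrix.of_apply, Pi.smul_apply, MulOpposite.smul_eq_mul_unop,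
      MulOpposite.unop_op, ho, Matrix.col_apply, hsymm o, Finset.mul_sum, ← Finset.sum_sub_distrib,
      zero_mul, mul_zero, sub_zero]
    exact Finset.sum_congr rfl fun i _ => by ring
  have h2 : pairSum (fun i j => A i o + A j o - A i j) ξ =
      2 * s * ∑ i, A i o * ξ i - pairSum A ξ := by
    have h3 : ∑ i, ∑ j, A i o * ξ i * ξ j = s * ∑ i, A i o * ξ i := by
      rw [← Finset.sum_mul_sum, mul_comm]
    have h4 : ∑ i, ∑ j, A j o * ξ i * ξ j = s * ∑ i, A i o * ξ i := by
      rw [hs, Finset.sum_mul_sum]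
      exact Finset.sum_congr rfl fun i _ => Finset.sum_congr rfl fun j _ => by ring
    simp only [pairSum, add_mul, sub_mul, Finset.sum_add_distrib, Finset.sum_sub_distrib, h3, h4]
    ring
  linarith

/-- Schoenberg: `exp (-s A)` is positive semidefinite for a conditionally negative kernel `A`. -/
lemma IsCondNeg.pairSum_exp_neg_nonneg (hA : IsCondNeg A) (hsymm : ∀ i j, A i j = A j i)
    (hdiag : ∀ i, A i i = 0) {s : ℝ} (hs : 0 ≤ s) (ξ : ι → ℝ) :
    0 ≤ pairSum (fun i j => Real.exp (-(s * A i j))) ξ := by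
  cases isEmpty_or_nonempty ι with
  | inl _ => simp [pairSum]
  | inr hne =>
    obtain ⟨o⟩ := hne
    have hK : (Matrix.of fun i j => s * (A i o + A j o - A i j)).PosSemidef :=
      (hA.posSemidef hsymm (hdiag o)).smul hs
    refine (pairSum_exp_nonneg hK fun i => Real.exp (-(s * A i o)) * ξ i).trans_eq ?_
    refine Finset.sum_congr rfl fun i _ => Finset.sum_congr rfl fun j _ => ?_
    have : Real.exp (-(s * A i j)) = Real.exp (s * (A i o + A j o - A i j)) *
        Real.exp (-(s * A i o)) * Real.exp (-(s * A j o)) := by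
      rw [← Real.exp_add, ← Real.exp_add]
      ring_nf
    simp only [this]
    ring

lemma integral_pairSum {α : Type*} [MeasurableSpace α] {μ : Measure α} {F : α → ι → ι → ℝ}
    (hF : ∀ i j, Integrable (fun a => F a i j) μ) (ξ : ι → ℝ) :
    ∫ a, pairSum (F a) ξ ∂μ = pairSum (fun i j => ∫ a, F a i j ∂μ) ξ := by
  have hint : ∀ i j, Integrable (fun a => F a i j * ξ i * ξ j) μ :=
    fun i j => ((hF i j).mul_const _).mul_const _
  simp only [pairSum]
  rw [integral_finsetSum _ fun i _ => integrable_finsetSum _ fun j _ => hint i j]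
  refine Finset.sum_congr rfl fun i _ => ?_
  rw [integral_finsetSum _ fun j _ => hint i j]
  simp only [integral_mul_const]

lemma integrable_pairSum {α : Type*} [MeasurableSpace α] {μ : Measure α} {F : α → ι → ι → ℝ}
    (hF : ∀ i j, Integrable (fun a => F a i j) μ) (ξ : ι → ℝ) :
    Integrable (fun a => pairSum (F a) ξ) μ :=
  integrable_finsetSum _ fun i _ => integrable_finsetSum _ fun j _ =>
    ((hF i j).mul_const _).mul_const _

lemma IsCondNeg.pairSum_inv_nonneg (hA : IsCondNeg A) (hsymm : ∀ i j, A i j = A j i)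
    (hdiag : ∀ i, A i i = 0) (hnonneg : ∀ i j, 0 ≤ A i j) {t : ℝ} (ht : 0 < t) (ξ : ι → ℝ) :
    0 ≤ pairSum (fun i j => (t + A i j)⁻¹) ξ := by
  have hneg : ∀ i j, -(t + A i j) < 0 := fun i j => by linarith [hnonneg i j]
  have hint : ∀ i j, (t + A i j)⁻¹ = ∫ s in Ioi (0 : ℝ), Real.exp (-(t + A i j) * s) := by
    intro i j
    rw [integral_exp_mul_Ioi (hneg i j)]
    rw [mul_zero, Real.exp_zero, neg_div_neg_eq, one_div]
  simp only [hint]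
  rw [← integral_pairSum fun i j => integrableOn_exp_mul_Ioi (hneg i j) 0]
  refine setIntegral_nonneg measurableSet_Ioi fun s hs => ?_
  have : (fun i j => Real.exp (-(t + A i j) * s)) =
      fun i j => Real.exp (-(t * s)) * Real.exp (-(s * A i j)) := by
    ext i j
    rw [← Real.exp_add]
    ring_nf
  rw [this, pairSum_const_mul]
  exact mul_nonneg (Real.exp_pos _).le
    (hA.pairSum_exp_neg_nonneg hsymm hdiag (le_of_lt hs) ξ)

lemma eventually_pairSum_inv_pos (hdiag : ∀ i, A i i = 0) (hpos : ∀ i j, i ≠ j → 0 < A i j)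
    {ξ : ι → ℝ} (hξ : ξ ≠ 0) : ∀ᶠ t in 𝓝[>] (0 : ℝ), 0 < pairSum (fun i j => (t + A i j)⁻¹) ξ := by
  classical
  have hlim : Tendsto (fun t : ℝ => pairSum (fun i j => t * (t + A i j)⁻¹) ξ) (𝓝[>] 0)
      (𝓝 (pairSum (fun i j => if i = j then 1 else 0) ξ)) := by
    refine tendsto_finsetSum _ fun i _ => tendsto_finsetSum _ fun j _ =>
      Tendsto.mul_const _ (Tendsto.mul_const _ ?_)
    by_cases hij : i = j
    · subst hij
      simp only [hdiag, add_zero, if_true]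
      refine tendsto_const_nhds.congr' ?_
      filter_upwards [self_mem_nhdsWithin] with t ht
      exact (mul_inv_cancel₀ (ne_of_gt ht)).symm
    · have hne : (0 : ℝ) + A i j ≠ 0 := by simpa using (hpos i j hij).ne'
      have : ContinuousAt (fun t : ℝ => t * (t + A i j)⁻¹) 0 :=
        continuousAt_id.mul ((continuousAt_id.add continuousAt_const).inv₀ hne)
      simpa [hij] using this.tendsto.mono_left nhdsWithin_le_nhds
  have hlim_pos : 0 < pairSum (fun i j => if i = j then 1 else 0) ξ := by
    obtain ⟨i, hi⟩ := Function.ne_iff.mp hξ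
    simp only [pairSum, ite_mul, one_mul, zero_mul, Finset.sum_ite_eq, Finset.mem_univ, if_true]
    exact Finset.sum_pos' (fun i _ => mul_self_nonneg _)
      ⟨i, Finset.mem_univ i, mul_self_pos.mpr hi⟩
  filter_upwards [hlim.eventually_const_lt hlim_pos, self_mem_nhdsWithin] with t ht ht0
  rw [pairSum_const_mul] at ht
  exact pos_of_mul_pos_right ht (le_of_lt ht0)

/-- Fractional powers of a conditionally negative kernel are strictly conditionally negative. -/
lemma IsCondNeg.rpow (hA : IsCondNeg A) (hsymm : ∀ i j, A i j = A j i)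
    (hdiag : ∀ i, A i i = 0) (hpos : ∀ i j, i ≠ j → 0 < A i j) {a : ℝ} (ha : a ∈ Ioo (0 : ℝ) 1) :
    IsStrictCondNeg fun i j => A i j ^ a := by
  intro ξ hsum hξ
  have hnonneg : ∀ i j, 0 ≤ A i j := fun i j => by
    by_cases hij : i = j
    · rw [hij, hdiag]
    · exact (hpos i j hij).le
  have hint : ∀ i j, Integrable (fun t => Real.rpowIntegrand₀₁ a t (A i j))
      (volume.restrict (Ioi 0)) :=
    fun i j => Real.integrableOn_rpowIntegrand₀₁_Ioi ha (hnonneg i j)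
  have hform : ∀ t, pairSum (fun i j => Real.rpowIntegrand₀₁ a t (A i j)) ξ =
      -(t ^ a * pairSum (fun i j => (t + A i j)⁻¹) ξ) := by
    intro t
    have hconst : ∑ i, ∑ j, t⁻¹ * ξ i * ξ j = 0 := by
      simp only [← Finset.mul_sum, hsum, mul_zero, Finset.sum_const_zero]
    simp only [Real.rpowIntegrand₀₁]
    rw [pairSum_const_mul]
    simp only [pairSum, sub_mul, Finset.sum_sub_distrib, hconst]
    ring
  have hfun : (fun i j => A i j ^ a) = fun i j =>
      (∫ t in Ioi 0, Real.rpowIntegrand₀₁ a t 1)⁻¹ *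
        ∫ t in Ioi 0, Real.rpowIntegrand₀₁ a t (A i j) := by
    ext i j
    exact Real.rpow_eq_const_mul_integral ha (hnonneg i j)
  rw [hfun, pairSum_const_mul, ← integral_pairSum hint]
  refine mul_neg_of_pos_of_neg (inv_pos.mpr (Real.integral_rpowIntegrand₀₁_one_pos ha)) ?_
  have hintegrable := integrable_pairSum hint ξ
  simp only [hform] at hintegrable ⊢
  rw [integral_neg, neg_lt_zero,
    setIntegral_pos_iff_support_of_nonneg_ae _ (integrable_fun_neg_iff.mp hintegrable)]
  · obtain ⟨ε, hε, hsub⟩ :=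
      mem_nhdsGT_iff_exists_Ioo_subset.mp (eventually_pairSum_inv_pos hdiag hpos hξ)
    have hεpos : (0 : ℝ) < ε := hε
    have hvol : 0 < volume (Ioo 0 ε) := by simpa using hεpos
    refine hvol.trans_le (measure_mono fun t ht => ⟨?_, ht.1⟩)
    exact (mul_pos (Real.rpow_pos_of_pos ht.1 a) (hsub ht)).ne'
  · filter_upwards [ae_restrict_mem measurableSet_Ioi] with t ht
    exact mul_nonneg (Real.rpow_nonneg (le_of_lt ht) a)
      (hA.pairSum_inv_nonneg hsymm hdiag hnonneg ht ξ)

end QuadraticForms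

section DistPow

variable (X : Type*) [MetricSpace X]

open Classical in
/-- The kernel `d(x, y) ^ p`, set to zero on the diagonal also when `p = 0`. -/
noncomputable def distPow (p : ℝ) (x y : X) : ℝ :=
  if x = y then 0 else dist x y ^ p

variable {X}

lemma distPow_comm (p : ℝ) (x y : X) : distPow X p x y = distPow X p y x := by
  by_cases h : x = y
  · rw [h]
  · simp [distPow, h, Ne.symm h, dist_comm x y]

lemma distPow_self (p : ℝ) (x : X) : distPow X p x x = 0 := by
  simp [distPow]

lemma distPow_pos (p : ℝ) {x y : X} (h : x ≠ y) : 0 < distPow X p x y := by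
  simpa [distPow, h] using Real.rpow_pos_of_pos (dist_pos.mpr h) p

lemma distPow_eq {p : ℝ} (hp : 0 < p) (x y : X) : distPow X p x y = dist x y ^ p := by
  by_cases h : x = y
  · simp [distPow, h, Real.zero_rpow hp.ne']
  · simp [distPow, h]

lemma distPow_rpow (p : ℝ) {a : ℝ} (ha : 0 < a) (x y : X) :
    distPow X p x y ^ a = distPow X (p * a) x y := by
  by_cases h : x = y
  · simp [distPow, h, Real.zero_rpow ha.ne']
  · simp [distPow, h, Real.rpow_mul dist_nonneg]

lemma continuous_distPow (x y : X) : Continuous fun p => distPow X p x y := by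
  by_cases h : x = y
  · simpa [distPow, h] using continuous_const
  · simp only [distPow, h, if_false]
    exact continuous_const.rpow continuous_id fun _ => Or.inl (dist_ne_zero.mpr h)

variable [Fintype X]

lemma continuous_pairSum_distPow :
    Continuous fun z : ℝ × (X → ℝ) => pairSum (distPow X z.1) z.2 := by
  have h : ∀ x y : X, Continuous fun z : ℝ × (X → ℝ) => distPow X z.1 x y :=
    fun x y => (continuous_distPow x y).comp continuous_fst
  unfold pairSum
  fun_prop

lemma isNegType_iff_isCondNeg {p : ℝ} (hp : 0 < p) :
    IsNegType X p ↔ IsCondNeg (distPow X p) := by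
  classical
  have hfun : distPow X p = fun x y => dist x y ^ p := by
    ext x y
    exact distPow_eq hp x y
  rw [hfun]
  constructor
  · intro h ξ hξ
    have e := (Fintype.equivFin X).symm
    have := h _ e (ξ ∘ e) (by simpa using (e.sum_comp ξ).trans hξ)
    refine le_of_eq_of_le ?_ this
    simp only [pairSum, Function.comp]
    rw [← e.sum_comp]
    exact Finset.sum_congr rfl fun i _ => (e.sum_comp fun y => dist (e i) y ^ p * ξ (e i) * ξ y).symm
  · intro h N x ξ hξ
    refine le_of_eq_of_le ?_ (h (fun y => ∑ i, if x i = y then ξ i else 0) ?_)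
    · have h := fun y z : X => mul_right_comm (dist y z ^ p)
      simp only [pairSum, h, ← Finset.sum_mul, sum_mul_sum_fiber x ξ]
      exact Finset.sum_congr rfl fun i _ => by simp only [Finset.sum_mul, h]
    · rw [Finset.sum_comm]
      simpa using hξ

lemma isNegType_zero (X : Type*) [MetricSpace X] : IsNegType X 0 := by
  intro N x ξ hξ
  simp [← Finset.mul_sum, hξ]

lemma isStrictCondNeg_distPow_zero : IsStrictCondNeg (distPow X 0) := by
  classical
  intro ξ hsum hξ
  have h : pairSum (distPow X 0) ξ = -∑ x, ξ x * ξ x := by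
    have : ∀ x y, distPow X 0 x y * ξ x * ξ y = ξ x * ξ y - if x = y then ξ x * ξ y else 0 := by
      intro x y
      by_cases hxy : x = y <;> simp [distPow, hxy]
    simp [pairSum, this, Finset.sum_sub_distrib, ← Finset.mul_sum, hsum]
  obtain ⟨x, hx⟩ := Function.ne_iff.mp hξ
  rw [h, neg_lt_zero]
  exact Finset.sum_pos' (fun x _ => mul_self_nonneg _)
    ⟨x, Finset.mem_univ x, mul_self_pos.mpr hx⟩

lemma IsStrictCondNeg.isCondNeg {ι : Type*} [Fintype ι] {A : ι → ι → ℝ}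
    (hA : IsStrictCondNeg A) : IsCondNeg A := by
  intro ξ hξ
  by_cases h : ξ = 0
  · simp [h, pairSum]
  · exact (hA ξ hξ h).le

lemma isNegType_iff_isCondNeg_of_nonneg {p : ℝ} (hp : 0 ≤ p) :
    IsNegType X p ↔ IsCondNeg (distPow X p) := by
  obtain rfl | hp := hp.eq_or_lt
  · exact iff_of_true (isNegType_zero X) isStrictCondNeg_distPow_zero.isCondNeg
  · exact isNegType_iff_isCondNeg hp

/-- Strict negative type is an open condition on the exponent. -/
lemma IsStrictCondNeg.eventually {p : ℝ} (h : IsStrictCondNeg (distPow X p)) :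
    ∀ᶠ q in 𝓝 p, IsCondNeg (distPow X q) := by
  have hK : IsCompact ({ξ : X → ℝ | ∑ x, ξ x = 0} ∩ Metric.sphere 0 1) :=
    (isCompact_sphere 0 1).inter_left (isClosed_eq (by fun_prop) continuous_const)
  have := hK.eventually_forall_of_forall_eventually (x₀ := p)
    (P := fun q ξ => pairSum (distPow X q) ξ < 0) fun ξ hξ =>
      continuous_pairSum_distPow.continuousAt.eventually_lt_const
        (h ξ hξ.1 (ne_zero_of_mem_unit_sphere ⟨ξ, hξ.2⟩))
  filter_upwards [this] with q hq ξ hξ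
  by_cases h0 : ξ = 0
  · simp [h0, pairSum]
  · have hn : ‖ξ‖ ≠ 0 := norm_ne_zero_iff.mpr h0
    have := hq (‖ξ‖⁻¹ • ξ) ⟨by simp [← Finset.mul_sum, hξ], by simp [norm_smul, hn]⟩
    rw [pairSum_const_smul] at this
    exact (neg_of_mul_neg_right this (sq_nonneg _)).le

lemma isClosed_setOf_isNegType : IsClosed {p : ℝ | 0 ≤ p ∧ IsNegType X p} := by
  have : {p : ℝ | 0 ≤ p ∧ IsNegType X p} =
      Ici 0 ∩ ⋂ ξ : X → ℝ, ⋂ _ : ∑ x, ξ x = 0, {p | pairSum (distPow X p) ξ ≤ 0} := by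
    ext p
    simp only [mem_ofPred_eq, mem_inter_iff, mem_Ici, mem_iInter]
    exact and_congr_right fun hp => isNegType_iff_isCondNeg_of_nonneg hp
  rw [this]
  refine isClosed_Ici.inter (isClosed_iInter fun ξ => isClosed_iInter fun _ => ?_)
  have h := continuous_distPow (X := X)
  refine isClosed_le ?_ continuous_const
  unfold pairSum
  fun_prop

lemma mgr_mem (hfin : BddAbove {p : ℝ | 0 ≤ p ∧ IsNegType X p}) :
    mgr X ∈ {p : ℝ | 0 ≤ p ∧ IsNegType X p} :=
  isClosed_setOf_isNegType.csSup_mem ⟨0, le_rfl, isNegType_zero X⟩ hfin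

lemma not_isStrictCondNeg_mgr (hfin : BddAbove {p : ℝ | 0 ≤ p ∧ IsNegType X p}) :
    ¬ IsStrictCondNeg (distPow X (mgr X)) := by
  intro h
  obtain ⟨q, hq, hlt⟩ := ((h.eventually.filter_mono nhdsWithin_le_nhds).and
    (self_mem_nhdsWithin : Ioi (mgr X) ∈ 𝓝[>] mgr X)).exists
  have hq0 : 0 ≤ q := (mgr_mem hfin).1.trans (le_of_lt hlt)
  exact (mem_Ioi.mp hlt).not_ge
    (le_csSup hfin ⟨hq0, (isNegType_iff_isCondNeg_of_nonneg hq0).mpr hq⟩)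

lemma mgr_pos (hfin : BddAbove {p : ℝ | 0 ≤ p ∧ IsNegType X p}) : 0 < mgr X := by
  refine (mgr_mem hfin).1.lt_of_ne fun h => not_isStrictCondNeg_mgr hfin ?_
  rw [← h]
  exact isStrictCondNeg_distPow_zero

lemma isStrictCondNeg_of_lt_mgr (hfin : BddAbove {p : ℝ | 0 ≤ p ∧ IsNegType X p}) {p : ℝ}
    (hp : 0 < p) (hlt : p < mgr X) : IsStrictCondNeg (distPow X p) := by
  have hm : 0 < mgr X := mgr_pos hfin
  have ha : p / mgr X ∈ Ioo (0 : ℝ) 1 := ⟨div_pos hp hm, (div_lt_one hm).mpr hlt⟩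
  have h := ((isNegType_iff_isCondNeg hm).mp (mgr_mem hfin).2).rpow (distPow_comm _)
    (distPow_self _) (fun _ _ => distPow_pos _) ha
  simpa only [distPow_rpow _ ha.1, mul_div_cancel₀ _ hm.ne'] using h

end DistPow

section Singularity

variable {ι : Type*} [Fintype ι] {A : ι → ι → ℝ}

lemma pairSum_add (hsymm : ∀ i j, A i j = A j i) (ξ η : ι → ℝ) :
    pairSum A (ξ + η) = pairSum A ξ + 2 * (η ⬝ᵥ (Matrix.of A *ᵥ ξ)) + pairSum A η := by
  have hcross : ξ ⬝ᵥ (Matrix.of A *ᵥ η) = η ⬝ᵥ (Matrix.of A *ᵥ ξ) := by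
    have h : (Matrix.of A)ᵀ = Matrix.of A := Matrix.ext fun i j => hsymm j i
    rw [dotProduct_mulVec, ← mulVec_transpose, h, dotProduct_comm]
  simp only [pairSum_eq_dotProduct, mulVec_add, add_dotProduct, dotProduct_add, hcross]
  ring

variable [DecidableEq ι]

/-- A null vector of a conditionally negative form is mapped to a constant vector. -/
lemma IsCondNeg.mulVec_eq_const (hA : IsCondNeg A) (hsymm : ∀ i j, A i j = A j i) {ξ : ι → ℝ}
    (hsum : ∑ i, ξ i = 0) (hnull : pairSum A ξ = 0) (i j : ι) :
    (Matrix.of A *ᵥ ξ) i = (Matrix.of A *ᵥ ξ) j := by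
  set c := (Matrix.of A *ᵥ ξ) i - (Matrix.of A *ᵥ ξ) j with hc
  set η : ι → ℝ := Pi.single i 1 - Pi.single j 1 with hη
  have hηsum : ∑ k, η k = 0 := by simp [hη]
  have hηc : η ⬝ᵥ (Matrix.of A *ᵥ ξ) = c := by simp [hη, hc, sub_dotProduct]
  have key : ∀ s : ℝ, 0 ≤ -pairSum A η * (s * s) + (-2 * c) * s + 0 := by
    intro s
    have := hA (ξ + s • η) (by simp [Finset.sum_add_distrib, ← Finset.mul_sum, hsum, hηsum])
    rw [pairSum_add hsymm, pairSum_const_smul, smul_dotProduct, hηc, hnull, smul_eq_mul] at this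
    linarith
  have hdiscr := discrim_le_zero key
  have : c = 0 := by
    rw [discrim] at hdiscr
    nlinarith [sq_nonneg c]
  linarith

lemma IsCondNeg.singular_of_not_strict (hA : IsCondNeg A) (hsymm : ∀ i j, A i j = A j i)
    (hnot : ¬ IsStrictCondNeg A) : (Matrix.of A).det = 0 ∨ ((Matrix.of A).det ≠ 0 ∧ (Matrix.of A)⁻¹ *ᵥ (1 : ι → ℝ) ⬝ᵥ 1 = 0) := by
  refine or_iff_not_imp_left.mpr fun hdet => ⟨hdet, ?_⟩
  simp only [IsStrictCondNeg] at hnot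
  push Not at hnot
  obtain ⟨ξ, hsum, hξ, hge⟩ := hnot
  have hnull : pairSum A ξ = 0 := le_antisymm (hA ξ hsum) hge
  obtain ⟨i₀, -⟩ := Function.ne_iff.mp hξ
  set c := (Matrix.of A *ᵥ ξ) i₀ with hc
  have hAξ : Matrix.of A *ᵥ ξ = c • 1 := by
    ext i
    simp [hc, hA.mulVec_eq_const hsymm hsum hnull i i₀]
  have hinv : ξ = c • ((Matrix.of A)⁻¹ *ᵥ 1) := by
    rw [← mulVec_smul, ← hAξ, mulVec_mulVec, nonsing_inv_mul _ (isUnit_iff_ne_zero.mpr hdet),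
      one_mulVec]
  have hc0 : c ≠ 0 := by
    intro h0
    exact hξ (by rw [hinv, h0, zero_smul])
  have : c * ((Matrix.of A)⁻¹ *ᵥ (1 : ι → ℝ) ⬝ᵥ 1) = 0 := by
    rw [← smul_eq_mul, ← smul_dotProduct, ← hinv, dotProduct_one, hsum]
  exact (mul_eq_zero.mp this).resolve_left hc0

lemma IsStrictCondNeg.det_ne_zero [Nontrivial ι] (hA : IsStrictCondNeg A) (hsymm : ∀ i j, A i j = A j i)
    (hdiag : ∀ i, A i i = 0) (hpos : ∀ i j, i ≠ j → A i j ≠ 0) : (Matrix.of A).det ≠ 0 := by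
  intro hdet
  obtain ⟨ξ, hξ, hAξ⟩ := exists_mulVec_eq_zero_iff.mpr hdet
  have hnull : pairSum A ξ = 0 := by
    rw [pairSum_eq_dotProduct, hAξ, dotProduct_zero]
  obtain ⟨o, j, hoj⟩ := exists_pair_ne ι
  set s := ∑ i, ξ i with hs
  set η : ι → ℝ := ξ + (-s) • Pi.single o 1 with hη
  have hηsum : ∑ i, η i = 0 := by simp [hη, Finset.sum_add_distrib, ← Finset.mul_sum, ← hs]
  have hηnull : pairSum A η = 0 := by
    rw [hη, pairSum_add hsymm, hnull, hAξ, pairSum_const_smul]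
    have : pairSum A (Pi.single o 1) = 0 := by
      simp [pairSum, Pi.single_apply, hdiag]
    simp [this]
  have hη0 : η = 0 := by
    by_contra h
    exact (hA η hηsum h).ne hηnull
  have hξs : ξ = s • Pi.single o 1 := by
    have : ξ = η + s • Pi.single o 1 := by simp [hη]
    rw [this, hη0, zero_add]
  have hs0 : s ≠ 0 := by
    intro h
    exact hξ (by rw [hξs, h, zero_smul])
  have := congrFun hAξ j
  rw [hξs, mulVec_smul] at this
  simp [hs0, hpos j o hoj.symm] at this

lemma IsStrictCondNeg.inv_mulVec_one_ne_zero [Nonempty ι] (hA : IsStrictCondNeg A)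
    (hdet : (Matrix.of A).det ≠ 0) : (Matrix.of A)⁻¹ *ᵥ (1 : ι → ℝ) ⬝ᵥ 1 ≠ 0 := by
  intro h
  have hAu : Matrix.of A *ᵥ ((Matrix.of A)⁻¹ *ᵥ (1 : ι → ℝ)) = 1 := by
    rw [mulVec_mulVec, mul_nonsing_inv _ (isUnit_iff_ne_zero.mpr hdet), one_mulVec]
  refine (hA ((Matrix.of A)⁻¹ *ᵥ 1) (by rwa [← dotProduct_one]) ?_).ne ?_
  · intro h0
    rw [h0, mulVec_zero] at hAu
    exact zero_ne_one hAu
  · rw [pairSum_eq_dotProduct, hAu, h]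

end Singularity

end SanchezFormula

/-- Sánchez's formula: if `mgr(X) < ∞`, then
`mgr(X) = min {p > 0 : det (D_p) = 0, or D_p is invertible and ⟨D_p⁻¹ 𝟙, 𝟙⟩ = 0}`. -/
theorem sanchez_formula (n : ℕ) [MetricSpace (Fin (n + 1))]
    (hfin : BddAbove {p : ℝ | 0 ≤ p ∧ IsNegType (Fin (n + 1)) p}) :
    IsLeast
      {p : ℝ | 0 < p ∧ ((Dmat n p).det = 0 ∨
        ((Dmat n p).det ≠ 0 ∧ (Dmat n p)⁻¹ *ᵥ (1 : Fin (n + 1) → ℝ) ⬝ᵥ 1 = 0))}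
      (mgr (Fin (n + 1))) := by
  have hD : ∀ p : ℝ, 0 < p → Dmat n p = Matrix.of (distPow (Fin (n + 1)) p) := by
    intro p hp
    ext i j
    exact (distPow_eq hp i j).symm
  have hm := mgr_pos hfin
  constructor
  · refine ⟨hm, ?_⟩
    rw [hD _ hm]
    exact ((isNegType_iff_isCondNeg hm).mp (mgr_mem hfin).2).singular_of_not_strict
      (distPow_comm _) (not_isStrictCondNeg_mgr hfin)
  · rintro p ⟨hp, hsing⟩
    by_contra! hlt
    have hstrict := isStrictCondNeg_of_lt_mgr hfin hp hlt
    have hnontrivial : Nontrivial (Fin (n + 1)) := by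
      by_contra hsub
      rw [not_nontrivial_iff_subsingleton] at hsub
      refine not_isStrictCondNeg_mgr hfin fun ξ hsum hξ => absurd ?_ hξ
      ext i
      rwa [Fintype.sum_subsingleton _ i] at hsum
    rw [hD p hp] at hsing
    have hdet := hstrict.det_ne_zero (distPow_comm _) (distPow_self _)
      fun i j hij => (distPow_pos p hij).ne'
    exact hsing.elim hdet fun h => hstrict.inv_mulVec_one_ne_zero hdet h.2
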